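/- Let Δ be a d-dimensional stacked simplicial complex and let k be an integer with 0 ≤ k ≤ d. Then the face poset of Δ can be written as a union of pairwise disjoint rank k boolean intervals such that the set of minimal elements of these intervals is a subcomplex of Δ. -/

import Mathlib

open Finset

/-- `pairs` is a family of pairwise disjoint rank `k` boolean intervals whose union is `P`. -/
def IsBooleanDecomposition {V : Type*} [DecidableEq V] (k : ℕ)
    (pairs : Set (Finset V × Finset V)) (P : Set (Finset V)) : Prop :=
  (∀ p ∈ pairs, p.1 ⊆ p.2 ∧ (p.2 \ p.1).card = k) ∧
  (P = ⋃ p ∈ pairs, ↑(Finset.Icc p.1 p.2)) ∧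
  pairs.PairwiseDisjoint (fun p => (↑(Finset.Icc p.1 p.2) : Set (Finset V)))

/-- The complex generated by a list of faces: all subsets of the members of `L`. -/
def genL {V : Type*} [DecidableEq V] (L : List (Finset V)) : Finset (Finset V) :=
  L.toFinset.biUnion Finset.powerset

/-- `L = [F_1, …, F_j]` is a stacked shelling of a pure `d`-dimensional complex:
the `F_l` are distinct faces of cardinality `d + 1` and, for each `1 ≤ i ≤ j - 1`,
`⟨F_1, …, F_i⟩ ∩ ⟨F_{i+1}⟩` is the powerset of some `d`-element subset of `F_{i+1}`. -/
def IsStackedShelling {V : Type*} [DecidableEq V] (d : ℕ) (L : List (Finset V)) : Prop :=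
  L ≠ [] ∧ L.Nodup ∧ (∀ F ∈ L, F.card = d + 1) ∧
  ∀ i : Fin L.length, 0 < i.1 →
    ∃ R ⊆ L.get i, R.card = d ∧ genL (L.take i.1) ∩ (L.get i).powerset = R.powerset

/-- A stacked simplicial complex of dimension `d`: one generated by a stacked shelling. -/
def IsStacked {V : Type*} [DecidableEq V] (Δ : Finset (Finset V)) (d : ℕ) : Prop :=
  ∃ L : List (Finset V), IsStackedShelling d L ∧ Δ = genL L

/-- For pairwise disjoint `A`, `S`, `K`, the intervals `[A ∪ τ, A ∪ τ ∪ K]` with `τ ⊆ S`. -/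
def translatedIntervals {V : Type*} [DecidableEq V] (A S K : Finset V) :
    Set (Finset V × Finset V) :=
  {p | ∃ τ ⊆ S, p = (A ∪ τ, A ∪ τ ∪ K)}

theorem isBooleanDecomposition_translatedIntervals {V : Type*} [DecidableEq V]
    {A S K : Finset V} (hAS : Disjoint A S) (hAK : Disjoint A K) (hSK : Disjoint S K) :
    IsBooleanDecomposition K.card (translatedIntervals A S K)
      (↑(Finset.Icc A (A ∪ S ∪ K)) : Set (Finset V)) := by
  rw [Finset.disjoint_left] at hAS hAK hSK
  refine ⟨?_, ?_, ?_⟩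
  · rintro p ⟨τ, hτ, rfl⟩
    refine ⟨subset_union_left, ?_⟩
    congr 1
    ext x
    have := @hτ x
    have := @hAK x
    have := @hSK x
    simp only [mem_sdiff, mem_union]
    tauto
  · ext ρ
    simp only [Finset.mem_coe, Finset.mem_Icc, Set.mem_iUnion, exists_prop]
    constructor
    · rintro ⟨h1, h2⟩
      refine ⟨_, ⟨ρ ∩ S, inter_subset_right, rfl⟩, union_subset h1 inter_subset_left, ?_⟩
      intro x hx
      have := h2 hx
      simp only [mem_union, mem_inter] at this ⊢
      tauto
    · rintro ⟨p, ⟨τ, hτ, rfl⟩, h1, h2⟩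
      refine ⟨subset_union_left.trans h1, h2.trans ?_⟩
      exact union_subset_union (union_subset_union Subset.rfl hτ) Subset.rfl
  · have key {ρ : Finset V} (τ : Finset V) (hτ : τ ⊆ S) (h1 : A ∪ τ ⊆ ρ)
        (h2 : ρ ⊆ A ∪ τ ∪ K) : τ = ρ ∩ S := by
      refine Subset.antisymm (subset_inter (subset_union_right.trans h1) hτ) fun x hx => ?_
      obtain ⟨hxρ, hxS⟩ := mem_inter.1 hx
      rcases mem_union.1 (h2 hxρ) with hxAτ | hxK
      · exact (mem_union.1 hxAτ).resolve_left fun hxA => hAS hxA hxS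
      · exact absurd hxK (hSK hxS)
    rintro p ⟨τ, hτ, rfl⟩ q ⟨υ, hυ, rfl⟩ hne
    rw [Function.onFun, Set.disjoint_left]
    intro ρ h1 h2
    simp only [Finset.mem_coe, Finset.mem_Icc] at h1 h2
    apply hne
    rw [key τ hτ h1.1 h1.2, key υ hυ h2.1 h2.2]

theorem IsBooleanDecomposition.union {V : Type*} [DecidableEq V] {k : ℕ}
    {s t : Set (Finset V × Finset V)} {P Q : Set (Finset V)}
    (hs : IsBooleanDecomposition k s P) (ht : IsBooleanDecomposition k t Q)
    (hPQ : Disjoint P Q) : IsBooleanDecomposition k (s ∪ t) (P ∪ Q) := by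
  obtain ⟨hs1, rfl, hs3⟩ := hs
  obtain ⟨ht1, rfl, ht3⟩ := ht
  refine ⟨fun p hp => hp.elim (hs1 p) (ht1 p), by rw [Set.biUnion_union], ?_⟩
  rw [Set.pairwiseDisjoint_union]
  refine ⟨hs3, ht3, fun p hp q hq _ => hPQ.mono ?_ ?_⟩
  · exact Set.subset_biUnion_of_mem (u := fun p : Finset V × Finset V =>
      (↑(Finset.Icc p.1 p.2) : Set (Finset V))) hp
  · exact Set.subset_biUnion_of_mem (u := fun p : Finset V × Finset V =>
      (↑(Finset.Icc p.1 p.2) : Set (Finset V))) hq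

theorem mem_genL {V : Type*} [DecidableEq V] {L : List (Finset V)} {ρ : Finset V} :
    ρ ∈ genL L ↔ ∃ F ∈ L, ρ ⊆ F := by
  simp [genL]

theorem IsStackedShelling.of_append_singleton {V : Type*} [DecidableEq V] {d : ℕ}
    {L : List (Finset V)} {F : Finset V} (h : IsStackedShelling d (L ++ [F])) (hL : L ≠ []) :
    IsStackedShelling d L ∧
      ∃ R ⊆ F, R.card = d ∧ genL L ∩ F.powerset = R.powerset := by
  obtain ⟨-, hnd, hcard, hR⟩ := h
  refine ⟨⟨hL, (List.nodup_append.1 hnd).1, fun G hG => hcard G (by simp [hG]), ?_⟩, ?_⟩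
  · intro i hi
    have := hR ⟨i.1, by simp only [List.length_append]; omega⟩ hi
    simpa [List.getElem_append_left, List.take_append_of_le_length i.2.le] using this
  · have := hR ⟨L.length, by simp⟩ (List.length_pos_iff.2 hL)
    simpa using this

/-- Besides the decomposition, every facet contains a minimal element of the largest possible
cardinality `d + 1 - k`; this is what allows the next facet of the shelling to be attached. -/
theorem IsStackedShelling.exists_decomposition {V : Type*} [DecidableEq V] {d k : ℕ}
    (hk : k ≤ d) (L : List (Finset V)) (h : IsStackedShelling d L) :
    ∃ pairs : Set (Finset V × Finset V),
      IsBooleanDecomposition k pairs (↑(genL L) : Set (Finset V)) ∧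
      (∀ p ∈ pairs, ∀ τ, τ ⊆ p.1 → ∃ q ∈ pairs, q.1 = τ) ∧
      ∀ F ∈ L, ∃ p ∈ pairs, p.1 ⊆ F ∧ p.1.card = d + 1 - k := by
  induction L using List.reverseRecOn with
  | nil => exact absurd rfl h.1
  | append_singleton L F ih =>
    have hF : F.card = d + 1 := h.2.2.1 F (by simp)
    rcases eq_or_ne L [] with rfl | hL
    · obtain ⟨K, hKF, rfl⟩ := Finset.exists_subset_card_eq (s := F) (n := k) (by omega)
      refine ⟨translatedIntervals ∅ (F \ K) K, ?_, ?_, ?_⟩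
      · convert isBooleanDecomposition_translatedIntervals (disjoint_empty_left (F \ K))
          (disjoint_empty_left K) sdiff_disjoint using 1
        ext ρ
        simp [mem_genL, sdiff_union_of_subset hKF]
      · rintro p ⟨τ, hτ, rfl⟩ υ hυ
        exact ⟨_, ⟨υ, (hυ.trans (empty_union τ).subset).trans hτ, rfl⟩, empty_union υ⟩
      · intro G hG
        obtain rfl : G = F := by simpa using hG
        refine ⟨_, ⟨G \ K, Subset.rfl, rfl⟩, ?_, ?_⟩
        · simp
        · simp [card_sdiff_of_subset hKF, hF]
    · obtain ⟨hS, R, hRF, hRd, hR⟩ := h.of_append_singleton hL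
      obtain ⟨pairs, hdec, hsub, hbig⟩ := ih hS
      have hmem : ∀ ρ ⊆ F, (ρ ∈ genL L ↔ ρ ⊆ R) := by
        intro ρ hρ
        have := congrArg (ρ ∈ ·) hR
        simpa [hρ] using this
      obtain ⟨v, hv⟩ : ∃ v, F \ R = {v} := by
        rw [← card_eq_one, card_sdiff_of_subset hRF]
        omega
      have hvF : v ∈ F ∧ v ∉ R := by
        rw [← mem_sdiff, hv]; exact mem_singleton_self v
      have hFR : F = {v} ∪ R := by
        rw [← hv, sdiff_union_of_subset hRF]
      have hvL : ∀ ρ ∈ genL L, v ∉ ρ := by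
        intro ρ hρ hvρ
        have h1 : {v} ∈ genL L := by
          obtain ⟨G, hG, hρG⟩ := mem_genL.1 hρ
          exact mem_genL.2 ⟨G, hG, singleton_subset_iff.2 (hρG hvρ)⟩
        exact hvF.2 (singleton_subset_iff.1 ((hmem _ (singleton_subset_iff.2 hvF.1)).1 h1))
      obtain ⟨S, hSR, hScard, hSpairs⟩ :
          ∃ S ⊆ R, S.card = d - k ∧ ∀ τ ⊆ S, ∃ q ∈ pairs, q.1 = τ := by
        obtain ⟨G, hG, hRG⟩ := mem_genL.1 ((hmem R hRF).2 Subset.rfl)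
        obtain ⟨p, hp, hpG, hpcard⟩ := hbig G hG
        have hGcard := hS.2.2.1 G hG
        have h1 : (p.1 ∪ R).card ≤ d + 1 := hGcard ▸ card_le_card (union_subset hpG hRG)
        have h2 := card_union_add_card_inter p.1 R
        obtain ⟨S, hSp, hSc⟩ :=
          Finset.exists_subset_card_eq (s := p.1 ∩ R) (n := d - k) (by omega)
        exact ⟨S, hSp.trans inter_subset_right, hSc, fun τ hτ =>
          hsub p hp τ (hτ.trans (hSp.trans inter_subset_left))⟩
      have hKcard : (R \ S).card = k := by
        rw [card_sdiff_of_subset hSR]; omega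
      have hvS : Disjoint {v} S := disjoint_singleton_left.2 fun hx => hvF.2 (hSR hx)
      have hvK : Disjoint {v} (R \ S) :=
        disjoint_singleton_left.2 fun hx => hvF.2 (mem_sdiff.1 hx).1
      have hnew := isBooleanDecomposition_translatedIntervals hvS hvK disjoint_sdiff
      rw [hKcard, union_assoc, union_sdiff_of_subset hSR, ← hFR] at hnew
      refine ⟨pairs ∪ translatedIntervals {v} S (R \ S), ?_, ?_, ?_⟩
      · convert hdec.union hnew ?_ using 1
        · ext ρ
          simp only [Finset.mem_coe, Set.mem_union, Finset.mem_Icc,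
            singleton_subset_iff]
          constructor
          · intro hρ
            obtain ⟨G, hG, hρG⟩ := mem_genL.1 hρ
            rcases List.mem_append.1 hG with hG | hG
            · exact Or.inl (mem_genL.2 ⟨G, hG, hρG⟩)
            · obtain rfl := List.mem_singleton.1 hG
              by_cases hvρ : v ∈ ρ
              · exact Or.inr ⟨hvρ, hρG⟩
              · refine Or.inl ((hmem ρ hρG).2 fun x hx => ?_)
                have hxF := hρG hx
                rw [hFR, mem_union, mem_singleton] at hxF
                exact hxF.resolve_left fun hxv => hvρ (hxv ▸ hx)
          · rintro (hρ | ⟨-, hρ⟩)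
            · obtain ⟨G, hG, hρG⟩ := mem_genL.1 hρ
              exact mem_genL.2 ⟨G, by simp [hG], hρG⟩
            · exact mem_genL.2 ⟨F, by simp, hρ⟩
        · rw [Set.disjoint_left]
          intro ρ hρ hρ'
          exact hvL ρ hρ (singleton_subset_iff.1 (Finset.mem_Icc.1 hρ').1)
      · rintro p (hp | ⟨τ, hτ, rfl⟩) υ hυ
        · obtain ⟨q, hq, hqυ⟩ := hsub p hp υ hυ
          exact ⟨q, Or.inl hq, hqυ⟩
        · have hυS : υ \ {v} ⊆ S := (sdiff_le_iff.2 hυ).trans hτ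
          by_cases hvυ : v ∈ υ
          · exact ⟨_, Or.inr ⟨υ \ {v}, hυS, rfl⟩,
              union_sdiff_of_subset (singleton_subset_iff.2 hvυ)⟩
          · rw [sdiff_singleton_eq_erase, erase_eq_of_notMem hvυ] at hυS
            obtain ⟨q, hq, hqυ⟩ := hSpairs υ hυS
            exact ⟨q, Or.inl hq, hqυ⟩
      · intro G hG
        rcases List.mem_append.1 hG with hG | hG
        · obtain ⟨p, hp, hpG⟩ := hbig G hG
          exact ⟨p, Or.inl hp, hpG⟩
        · obtain rfl := List.mem_singleton.1 hG
          refine ⟨_, Or.inr ⟨S, Subset.rfl, rfl⟩, ?_, ?_⟩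
          · exact union_subset (singleton_subset_iff.2 hvF.1) (hSR.trans hRF)
          · rw [card_union_of_disjoint hvS, card_singleton]; omega

/-- For any `0 ≤ k ≤ d`, a `d`-dimensional stacked complex can be written as a union of
pairwise disjoint rank `k` boolean intervals whose minimal elements together form a
subcomplex of `Δ`. -/
theorem stacked_rank_k_boolean_decomposition
    {V : Type*} [DecidableEq V] (Δ : Finset (Finset V)) (d k : ℕ)
    (h : IsStacked Δ d) (hk : k ≤ d) :
    ∃ pairs : Set (Finset V × Finset V),
      IsBooleanDecomposition k pairs (↑Δ : Set (Finset V)) ∧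
      ∀ p ∈ pairs, ∀ τ, τ ⊆ p.1 → ∃ q ∈ pairs, q.1 = τ := by
  obtain ⟨L, hL, rfl⟩ := h
  obtain ⟨pairs, hdec, hsub, -⟩ := hL.exists_decomposition hk
  exact ⟨pairs, hdec, hsub⟩
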